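/- For d ≥ 2, let X_d be the oriented graph obtained from D_d by adding new vertices n₁, n₂, …, n_d and the arcs x₃ᵢ₋₂nᵢ and nᵢx₃ᵢ₊₁ for i = 1, 2, …, d, where subscripts of the x-vertices are taken modulo 3d. Then: (a) in any ios-injective homomorphism of X_d to C₃ʳ, the vertices x₁, n₁, x₄, n₂, …, x₃d₋₂, n_d all have the same image; and (b) for each vertex c of C₃ʳ, the partial mapping assigning all of x₁, n₁, x₄, n₂, …, x₃d₋₂, n_d the image c extends to an ios-injective homomorphism of X_d to C₃ʳ. -/

import Mathlib

/-- `f` is a homomorphism from the digraph with arc relation `A` to the digraph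
with arc relation `B`. -/
def IsHom {V W : Type*} (A : V → V → Prop) (B : W → W → Prop) (f : V → W) : Prop :=
  ∀ ⦃x y : V⦄, A x y → B (f x) (f y)

/-- `f` is injective on the in-neighbourhood and on the out-neighbourhood of
every vertex (separately). -/
def IosInj {V W : Type*} (A : V → V → Prop) (f : V → W) : Prop :=
  ∀ x : V, Set.InjOn f {y | A y x} ∧ Set.InjOn f {y | A x y}

/-- `f` is injective on the union of the in- and out-neighbourhood of every vertex. -/
def IotInj {V W : Type*} (A : V → V → Prop) (f : V → W) : Prop :=
  ∀ x : V, Set.InjOn f ({y | A y x} ∪ {y | A x y})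

/-- $C_3^r$: the directed 3-cycle with a loop added at every vertex. -/
def C3rArc (i j : Fin 3) : Prop := j = i ∨ j = i + 1

/-- The oriented graph \$D_d\$: the directed cycle \$v_1, \\dots, v_{6d}, v_1\$
(here `Sum.inl i` is \$v_{i+1}\$) together with vertices \$x_1, \\dots, x_{3d}\$
(here `Sum.inr t` is \$x_{t+1}\$) and arcs \$v_{2t}x_t\$ and \$x_tv_{2t-1}\$ for
\$t = 1, \\dots, 3d\$. -/
def DdArc (d : ℕ) : (Fin (6*d) ⊕ Fin (3*d)) → (Fin (6*d) ⊕ Fin (3*d)) → Prop :=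
  fun a b =>
    match a, b with
    | .inl i, .inl j => (j : ℕ) = ((i : ℕ) + 1) % (6*d)
    | .inl i, .inr t => (i : ℕ) = 2*(t : ℕ) + 1
    | .inr t, .inl i => (i : ℕ) = 2*(t : ℕ)
    | .inr _, .inr _ => False

/-- The oriented graph $X_d$: $D_d$ together with new vertices
$n_1, \dots, n_d$ (here `Sum.inr i` is $n_{i+1}$) and arcs $x_{3i-2}n_i$ and
$n_ix_{3i+1}$ for $i = 1, \dots, d$, subscripts of the $x$'s modulo $3d$. -/
def XdArc (d : ℕ) :
    ((Fin (6*d) ⊕ Fin (3*d)) ⊕ Fin d) → ((Fin (6*d) ⊕ Fin (3*d)) ⊕ Fin d) → Prop :=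
  fun a b =>
    match a, b with
    | .inl p, .inl q => DdArc d p q
    | .inl (.inr t), .inr i => (t : ℕ) = 3*(i : ℕ)
    | .inl (.inl _), .inr _ => False
    | .inr i, .inl (.inr t) => (t : ℕ) = (3*((i : ℕ) + 1)) % (3*d)
    | .inr _, .inl (.inl _) => False
    | .inr _, .inr _ => False

/-- Two consecutive triangles `v → w → x → v` and `v' → w' → x' → v'` joined by an arc `w → v'`:
under local injectivity the second image is the first one shifted by one. -/
theorem C3rArc.shift_of_consecutive_triangles :
    ∀ v w x v' w' x' : Fin 3, C3rArc v w → C3rArc w x → C3rArc x v →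
      C3rArc v' w' → C3rArc w' x' → C3rArc x' v' → C3rArc w v' → v' ≠ x → x' ≠ w →
      x' = x + 1 := by
  unfold C3rArc
  decide

theorem C3rArc.antisymm : ∀ {a b : Fin 3}, C3rArc a b → C3rArc b a → b = a := by
  unfold C3rArc
  decide

theorem Nat.mod_cases_of_le {a m : ℕ} (h : a ≤ m) : a < m ∧ a % m = a ∨ a = m ∧ a % m = 0 := by
  rcases h.lt_or_eq with h | h
  · exact .inl ⟨h, Nat.mod_eq_of_lt h⟩
  · exact .inr ⟨h, by simp [h]⟩

/-- In an ios-injective homomorphism of `X_d` to `C_3^r`, the image of `x_{t+1}` is that of `x_t`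
shifted by one. -/
theorem XdArc.map_x_succ {d : ℕ} {f : ((Fin (6*d) ⊕ Fin (3*d)) ⊕ Fin d) → Fin 3}
    (hf : IsHom (XdArc d) C3rArc f) (hi : IosInj (XdArc d) f) (t : ℕ) (ht : t + 1 < 3*d) :
    f (.inl (.inr ⟨t + 1, ht⟩)) = f (.inl (.inr ⟨t, by omega⟩)) + 1 := by
  have hvw : ∀ (t : ℕ) (h : t < 3*d),
      XdArc d (.inl (.inl ⟨2*t, by omega⟩)) (.inl (.inl ⟨2*t+1, by omega⟩)) := fun t h => by
    simp only [XdArc, DdArc]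
    exact (Nat.mod_eq_of_lt (by omega)).symm
  have hwx : ∀ (t : ℕ) (h : t < 3*d),
      XdArc d (.inl (.inl ⟨2*t+1, by omega⟩)) (.inl (.inr ⟨t, h⟩)) := fun t h => by
    simp [XdArc, DdArc]
  have hxv : ∀ (t : ℕ) (h : t < 3*d),
      XdArc d (.inl (.inr ⟨t, h⟩)) (.inl (.inl ⟨2*t, by omega⟩)) := fun t h => by
    simp [XdArc, DdArc]
  have hwv : XdArc d (.inl (.inl ⟨2*t+1, by omega⟩)) (.inl (.inl ⟨2*(t+1), by omega⟩)) := by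
    simp only [XdArc, DdArc]
    exact (Nat.mod_eq_of_lt (by omega)).symm
  have ht' : t < 3*d := by omega
  refine C3rArc.shift_of_consecutive_triangles _ _ _ _ _ _
    (hf (hvw t ht')) (hf (hwx t ht')) (hf (hxv t ht'))
    (hf (hvw _ ht)) (hf (hwx _ ht)) (hf (hxv _ ht)) (hf hwv) (fun h => ?_) (fun h => ?_)
  · simpa using (hi (.inl (.inl ⟨2*t+1, by omega⟩))).2 hwv (hwx t ht') h
  · simpa using (hi (.inl (.inl ⟨2*(t+1), by omega⟩))).1 (hxv _ ht) hwv h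

theorem XdArc.map_x_three_mul {d : ℕ} {f : ((Fin (6*d) ⊕ Fin (3*d)) ⊕ Fin d) → Fin 3}
    (hf : IsHom (XdArc d) C3rArc f) (hi : IosInj (XdArc d) f) (s : ℕ) (hs : 3*s < 3*d) :
    f (.inl (.inr ⟨3*s, hs⟩)) = f (.inl (.inr ⟨0, by omega⟩)) := by
  induction s with
  | zero => rfl
  | succ s ih =>
    rw [← ih (by omega)]
    have three : ∀ a : Fin 3, a + 1 + 1 + 1 = a := by decide
    exact (map_x_succ hf hi (3*s+2) (by omega)).trans <| by
      rw [map_x_succ hf hi (3*s+1) (by omega), map_x_succ hf hi (3*s) (by omega), three]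

theorem XdArc.map_n {d : ℕ} {f : ((Fin (6*d) ⊕ Fin (3*d)) ⊕ Fin d) → Fin 3}
    (hf : IsHom (XdArc d) C3rArc f) (hi : IosInj (XdArc d) f) (s : ℕ) (hs : s < d) :
    f (.inr ⟨s, hs⟩) = f (.inl (.inr ⟨0, by omega⟩)) := by
  have hpos : 0 < 3*d := by omega
  have hin : XdArc d (.inl (.inr ⟨3*s, by omega⟩)) (.inr ⟨s, hs⟩) := rfl
  have hout : XdArc d (.inr ⟨s, hs⟩) (.inl (.inr ⟨(3*(s+1)) % (3*d), Nat.mod_lt _ hpos⟩)) := rfl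
  have h_out := hf hout
  have h_in := hf hin
  have hx : f (.inl (.inr ⟨(3*(s+1)) % (3*d), Nat.mod_lt _ hpos⟩)) =
      f (.inl (.inr ⟨0, hpos⟩)) := by
    rcases Nat.mod_cases_of_le (a := 3*(s+1)) (m := 3*d) (by omega) with ⟨h, e⟩ | ⟨-, e⟩
    · simpa only [e] using map_x_three_mul hf hi (s+1) (by omega)
    · simp only [e]
  rw [hx] at h_out
  rw [map_x_three_mul hf hi s (by omega)] at h_in
  exact C3rArc.antisymm h_in h_out

/-- The colouring of `X_d` sending every `x_{3i-2}` and every `n_i` to `c`, and each triangle of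
`D_d` onto the directed 3-cycle. -/
def XdColoring (d : ℕ) (c : Fin 3) : ((Fin (6*d) ⊕ Fin (3*d)) ⊕ Fin d) → Fin 3
  | .inl (.inl j) => Fin.ofNat 3 (c + ((j : ℕ) + 1) / 2 + 1)
  | .inl (.inr t) => Fin.ofNat 3 (c + t)
  | .inr _ => c

theorem C3rArc_iff (a b : Fin 3) :
    C3rArc a b ↔ (b : ℕ) = a ∨ (b : ℕ) = ((a : ℕ) + 1) % 3 := by
  unfold C3rArc
  revert a b
  decide

theorem XdColoring.isHom (d : ℕ) (c : Fin 3) : IsHom (XdArc d) C3rArc (XdColoring d c) := by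
  have hc := c.isLt
  rintro ((i | t) | n) ((j | u) | m) h <;> simp only [XdArc, DdArc] at h <;>
    simp only [C3rArc_iff, XdColoring, Fin.ofNat]
  · have := Nat.mod_cases_of_le (a := i + 1) (m := 6*d) (by omega)
    omega
  · omega
  · omega
  · omega
  · have := Nat.mod_cases_of_le (a := 3*(n + 1)) (m := 3*d) (by omega)
    omega

theorem XdColoring.iosInj (d : ℕ) (c : Fin 3) : IosInj (XdArc d) (XdColoring d c) := by
  have hc := c.isLt
  have hv := fun i : Fin (6*d) =>
    Nat.mod_cases_of_le (a := i + 1) (m := 6*d) (by omega)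
  have hn := fun n : Fin d =>
    Nat.mod_cases_of_le (a := 3*(n + 1)) (m := 3*d) (by omega)
  rintro ((i | t) | n) <;> constructor <;>
    rintro ((j | u) | m) h ((j' | u') | m') h' e <;>
    simp only [Set.mem_ofPred_eq, XdArc, DdArc] at h h' <;>
    simp only [Fin.ext_iff, XdColoring, Fin.ofNat] at e <;>
    simp only [Sum.inl.injEq, Sum.inr.injEq, Fin.ext_iff, reduceCtorEq] <;>
    grind

/-- (a) In any ios-injective homomorphism of $X_d$ to $C_3^r$, the vertices
$x_1, n_1, x_4, n_2, \dots, x_{3d-2}, n_d$ all have the same image; and (b) any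
partial mapping assigning all of these vertices the same image extends to an
ios-injective homomorphism of $X_d$ to $C_3^r$. -/
theorem Xd_ios_to_C3r (d : ℕ) (hd : 2 ≤ d) :
    (∀ f : ((Fin (6*d) ⊕ Fin (3*d)) ⊕ Fin d) → Fin 3,
      IsHom (XdArc d) C3rArc f → IosInj (XdArc d) f →
      ∀ (s : ℕ) (hs : s < d),
        f (Sum.inl (Sum.inr ⟨3*s, by omega⟩)) = f (Sum.inr ⟨0, by omega⟩) ∧
        f (Sum.inr ⟨s, hs⟩) = f (Sum.inr ⟨0, by omega⟩)) ∧
    (∀ c : Fin 3, ∃ f : ((Fin (6*d) ⊕ Fin (3*d)) ⊕ Fin d) → Fin 3,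
      IsHom (XdArc d) C3rArc f ∧ IosInj (XdArc d) f ∧
      ∀ (s : ℕ) (hs : s < d),
        f (Sum.inl (Sum.inr ⟨3*s, by omega⟩)) = c ∧ f (Sum.inr ⟨s, hs⟩) = c) := by
  refine ⟨fun f hf hi s hs => ?_, fun c => ⟨XdColoring d c, XdColoring.isHom d c,
    XdColoring.iosInj d c, fun s hs => ⟨?_, rfl⟩⟩⟩
  · rw [XdArc.map_n hf hi 0 (by omega), XdArc.map_n hf hi s hs]
    exact ⟨XdArc.map_x_three_mul hf hi s (by omega), rfl⟩
  · have hc := c.isLt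
    simp only [XdColoring, Fin.ofNat, Fin.ext_iff]
    omega
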